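/- Let μ be a Borel probability measure on [0,1] with μ(X) = μ({1−t : t ∈ X}) for every Borel set X ⊆ [0,1], let f(x) = ∫₀¹ x/((1−t)x+t) dμ(t) for x > 0, and let r be the scalar-curvature function of f. If 12·(∫₀¹ t(1−t) dμ(t))² − ∫₀¹ t(t−1)(20t²−40t+13) dμ(t) < 0, then r has a strict local minimum at the origin: there exists ε > 0 such that r(a) > 6 + 36·f″(1) for all a with 0 < |a| < ε, and lim_{a→0} r(a) = 6 + 36·f″(1). -/

import Mathlib

open MeasureTheory Filter Topology

/-- The scalar-curvature function `r(a)` of the monotone metric on `2×2` density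
matrices induced by `f`, at the state with eigenvalues `(1±a)/2`;
here `c = (1−a)/(1+a)`. -/
noncomputable def scurv (f : ℝ → ℝ) (a : ℝ) : ℝ :=
  14*(a - 1) * (deriv f ((1-a)/(1+a)))^2 / ((1+a)^3 * (f ((1-a)/(1+a)))^2)
    + 2*(a^2 + 7*a - 6) * deriv f ((1-a)/(1+a)) / ((1+a)^2 * a * f ((1-a)/(1+a)))
    + 8*(1 - a) * iteratedDeriv 2 f ((1-a)/(1+a)) / ((1+a)^3 * f ((1-a)/(1+a)))
    + 2*(1+a) * f ((1-a)/(1+a)) / a^2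
    + (3*a^3 + 5*a^2 + 8*a - 4) / (2*(1+a)*a^2)


/-- The polynomial remainder of the expansion of the scalar curvature. -/
noncomputable def remP (a p q u v w : ℝ) : ℝ :=
((-8)*w+(-12)*v+(4)*u+(60)*q
 + a*((-20)+(-12)*v+(12)*u+(112)*q+(-240)*p*q+(44)*p^2+(88)*p^3
 + a*((8)*w+(-12)*v+(12)*u+(60)*q+(-8)*p*w+(16)*p*v+(-24)*p*u+(-80)*p*q
 + a*((-12)*v+(12)*u+(8)*q+(-208)*q^2+(-40)*p+(16)*p*v+(-16)*p*u+(336)*p*q+(-44)*p^2+(-40)*p^2*q+(-72)*p^3+(60)*p^4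
 + a*((8)*u+(-8)*q*w+(44)*q*v+(-88)*q*u+(-220)*q^2+(8)*p*w+(-40)*p*v+(24)*p*u+(200)*p*q+(60)*p^2*u
 + a*((-7)*v^2+(-8)*u*w+(-12)*u*v+(8)*u^2+(-40)*q+(114)*q*v+(16)*q*u+(-27)*q^2+(-40)*p*v+(40)*p*u+(24)*p*q+(-224)*p*q^2+(-20)*p^2+(68)*p^2*q+(-16)*p^3+(120)*p^3*q+(-60)*p^4
 + a*((-14)*v^2+(-40)*u+(2)*u*v+(12)*u^2+(8)*q*w+(72)*q*v+(82)*q*u+(-10)*q^2+(24)*p*u+(-248)*p*q*u+(-32)*p^2*u+(120)*p^3*u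
 + a*((-7)*v^2+(8)*u*w+(16)*u*v+(-3)*u^2+(2)*q*v+(-12)*q*u+(5)*q^2+(-96)*q^3+(-24)*p*u^2+(-40)*p*q+(232)*p*q^2+(-28)*p^2*q+(60)*p^2*q^2+(-120)*p^3*q
 + a*((2)*u*v+(-2)*u^2+(10)*q*u+(-188)*q^2*u+(-40)*p*u+(264)*p*q*u+(-28)*p^2*u+(120)*p^2*q*u+(-120)*p^3*u
 + a*((5)*u^2+(-88)*q*u^2+(-20)*q^2+(92)*q^3+(32)*p*u^2+(-8)*p*q^2+(60)*p^2*u^2+(-60)*p^2*q^2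
 + a*((4)*u^3+(-40)*q*u+(176)*q^2*u+(-16)*p*q*u+(-120)*p^2*q*u
 + a*((-20)*u^2+(76)*q*u^2+(4)*q^3+(-8)*p*u^2+(-60)*p^2*u^2
 + a*((-8)*u^3+(12)*q^2*u
 + a*((12)*q*u^2
 + a*((4)*u^3)))))))))))))))

lemma scurv_alg (a p q u v w F D S : ℝ) (ha : a ≠ 0) (h1 : 1 + a ≠ 0) (h2 : 1 - a ≠ 0)
    (hg : 1 + p*a^2 + q*a^4 + a^5*u ≠ 0)
    (hF : F = (1 - a) * (1 + p*a^2 + q*a^4 + a^5*u))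
    (hD : D = (1 + a)^2 / 2 * (1 - 2*a*p + 3*a^2*p - 4*a^3*q + a^4*v))
    (hS : S = -(1 + a)^3 / 2 * (1 - p + 6*a^2*(p - q) + a^3*w)) :
    (14*(a - 1) * D^2 / ((1+a)^3 * F^2)
    + 2*(a^2 + 7*a - 6) * D / ((1+a)^2 * a * F)
    + 8*(1 - a) * S / ((1+a)^3 * F)
    + 2*(1+a) * F / a^2
    + (3*a^3 + 5*a^2 + 8*a - 4) / (2*(1+a)*a^2)
    - (-12 + 18*p) - (-10*(1+p+3*p^2-5*q))*a^2) * (2*(1-a)*(1+a)*(1 + p*a^2 + q*a^4 + a^5*u)^2)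
    = a^3 * remP a p q u v w := by
  obtain ⟨g, hgd⟩ : ∃ g, g = 1 + p*a^2 + q*a^4 + a^5*u := ⟨_, rfl⟩
  obtain ⟨h, hhd⟩ : ∃ h, h = 1 - 2*a*p + 3*a^2*p - 4*a^3*q + a^4*v := ⟨_, rfl⟩
  obtain ⟨k, hkd⟩ : ∃ k, k = 1 - p + 6*a^2*(p - q) + a^3*w := ⟨_, rfl⟩
  rw [← hgd] at hg hF ⊢
  rw [← hhd] at hD
  rw [← hkd] at hS
  have e1 : 14*(a - 1) * D^2 / ((1+a)^3 * F^2) = -(7/2)*(1+a)*h^2/((1-a)*g^2) := by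
    rw [hD, hF]; field_simp; ring
  have e2 : 2*(a^2 + 7*a - 6) * D / ((1+a)^2 * a * F) = (a^2+7*a-6)*h/(a*(1-a)*g) := by
    rw [hD, hF]; field_simp
  have e3 : 8*(1 - a) * S / ((1+a)^3 * F) = -4*k/g := by
    rw [hS, hF]; field_simp; ring
  have e4 : 2*(1+a) * F / a^2 = 2*(1+a)*(1-a)*g/a^2 := by
    rw [hF]; ring
  rw [e1, e2, e3, e4]
  have key : -7*(1+a)^2*h^2*a^2+2*a*(1+a)*(a^2+7*a-6)*h*g-8*(1-a^2)*k*g*a^2+4*(1-a^2)^2*g^3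
      +(3*a^3+5*a^2+8*a-4)*(1-a)*g^2-2*(1-a^2)*g^2*a^2*(-12+18*p+(-10*(1+p+3*p^2-5*q))*a^2)
      = a^5 * remP a p q u v w := by
    rw [hgd, hhd, hkd, remP]; ring
  apply mul_left_cancel₀ (pow_ne_zero 2 ha)
  rw [show a^2 * (a^3 * remP a p q u v w) = a^5 * remP a p q u v w by ring, ← key]
  field_simp
  ring

lemma remP_bdd (p q : ℝ) : ∃ K > 0, ∀ a u v w : ℝ, |a| ≤ 1/2 → |u| ≤ 2 → |v| ≤ 56 → |w| ≤ 152 →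
    |remP a p q u v w| ≤ K := by
  have hc : Continuous (fun x : ℝ × ℝ × ℝ × ℝ => remP x.1 p q x.2.1 x.2.2.1 x.2.2.2) := by
    unfold remP; fun_prop
  obtain ⟨K, hK⟩ := ((isCompact_Icc (a := (-(1/2):ℝ)) (b := 1/2)).prod
    ((isCompact_Icc (a := (-2:ℝ)) (b := 2)).prod ((isCompact_Icc (a := (-56:ℝ)) (b := 56)).prod
    (isCompact_Icc (a := (-152:ℝ)) (b := 152))))).exists_bound_of_continuousOn hc.continuousOn
  refine ⟨|K| + 1, by positivity, fun a u v w ha hu hv hw => ?_⟩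
  have := hK (a, u, v, w) ⟨abs_le.1 ha, abs_le.1 hu, abs_le.1 hv, abs_le.1 hw⟩
  simp only [Real.norm_eq_abs] at this
  linarith [le_abs_self K]


lemma sym_integral (μ : Measure ℝ)
    (hsym : ∀ X : Set ℝ, MeasurableSet X → X ⊆ Set.Icc 0 1 →
      μ X = μ ((fun t => 1 - t) '' X)) (φ : ℝ → ℝ) (hφ : Measurable φ) :
    ∫ t in Set.Icc (0:ℝ) 1, φ (1 - t) ∂μ = ∫ t in Set.Icc (0:ℝ) 1, φ t ∂μ := by
  have hm : Measurable (fun t : ℝ => 1 - t) := by fun_prop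
  have hmap : Measure.map (fun t : ℝ => 1 - t) (μ.restrict (Set.Icc 0 1))
      = μ.restrict (Set.Icc 0 1) := by
    ext X hX
    rw [Measure.map_apply hm hX, Measure.restrict_apply (hm hX), Measure.restrict_apply hX,
      hsym (X ∩ Set.Icc 0 1) (hX.inter measurableSet_Icc) Set.inter_subset_right]
    congr 1
    ext t
    simp only [Set.mem_inter_iff, Set.mem_preimage, Set.mem_image, Set.mem_Icc]
    constructor
    · rintro ⟨h1, h2, h3⟩
      exact ⟨1 - t, ⟨h1, by linarith, by linarith⟩, by ring⟩
    · rintro ⟨s, ⟨h1, h2, h3⟩, rfl⟩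
      refine ⟨by simpa using h1, by linarith, by linarith⟩
  conv_rhs => rw [← hmap]
  rw [integral_map hm.aemeasurable hφ.aestronglyMeasurable]


lemma int_bdd (ν : Measure ℝ) [IsProbabilityMeasure ν] (hν : ∀ᵐ t ∂ν, t ∈ Set.Icc (0:ℝ) 1) (φ : ℝ → ℝ) (hφ : Measurable φ)
    (B : ℝ) (hB : ∀ t ∈ Set.Icc (0:ℝ) 1, |φ t| ≤ B) : Integrable φ ν :=
  Integrable.of_bound hφ.aestronglyMeasurable B
    (hν.mono fun t ht => by simpa using hB t ht)

lemma int_pow (ν : Measure ℝ) [IsProbabilityMeasure ν] (hν : ∀ᵐ t ∂ν, t ∈ Set.Icc (0:ℝ) 1) (n : ℕ) : Integrable (fun t : ℝ => (1 - 2*t)^n) ν := by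
  refine int_bdd ν hν _ (by fun_prop) 1 (fun t ht => ?_)
  rw [abs_pow]
  exact pow_le_one₀ (abs_nonneg _) (abs_le.2 ⟨by linarith [ht.2], by linarith [ht.1]⟩)

/-- Expansion of an integral with bounded remainder. -/
lemma expand_int (ν : Measure ℝ) [IsProbabilityMeasure ν] (hν : ∀ᵐ t ∂ν, t ∈ Set.Icc (0:ℝ) 1)
    (h1 : ∫ t, (1 - 2*t) ∂ν = 0) (h3 : ∫ t, (1 - 2*t)^3 ∂ν = 0)
    (φ U : ℝ → ℝ) (c0 c1 c2 c3 c4 d B : ℝ) (hU : Measurable U)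
    (hB : ∀ t ∈ Set.Icc (0:ℝ) 1, |U t| ≤ B)
    (he : ∀ t ∈ Set.Icc (0:ℝ) 1, φ t = c0 + c1*(1-2*t) + c2*(1-2*t)^2 + c3*(1-2*t)^3
      + c4*(1-2*t)^4 + d * U t) :
    ∃ ρ : ℝ, |ρ| ≤ B ∧ ∫ t, φ t ∂ν
      = c0 + c2 * (∫ t, (1-2*t)^2 ∂ν) + c4 * (∫ t, (1-2*t)^4 ∂ν) + d * ρ := by
  have iU := int_bdd ν hν U hU B hB
  have i1 : Integrable (fun t : ℝ => 1 - 2*t) ν := by simpa using int_pow ν hν 1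
  have i2 := int_pow ν hν 2
  have i3 := int_pow ν hν 3
  have i4 := int_pow ν hν 4
  refine ⟨∫ t, U t ∂ν, ?_, ?_⟩
  · have := norm_integral_le_of_norm_le_const (μ := ν) (f := U) (C := B)
      (hν.mono fun t ht => by simpa using hB t ht)
    simpa using this
  · rw [integral_congr_ae (hν.mono fun t ht => he t ht)]
    rw [integral_add (by fun_prop) (by fun_prop), integral_add (by fun_prop) (by fun_prop),
      integral_add (by fun_prop) (by fun_prop), integral_add (by fun_prop) (by fun_prop),
      integral_add (by fun_prop) (by fun_prop)]
    simp only [integral_const_mul, h1, h3]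
    simp

lemma den_lb {x t y : ℝ} (hx : 0 < x) (ht : t ∈ Set.Icc (0:ℝ) 1) (hy : x/2 < y) :
    min (x/2) 1 ≤ (1 - t) * y + t := by
  have h1 := min_le_left (x/2) 1
  have h2 := min_le_right (x/2) 1
  nlinarith [ht.1, ht.2, mul_nonneg (sub_nonneg.2 ht.2) (sub_nonneg.2 (h1.trans hy.le)),
    mul_nonneg ht.1 (sub_nonneg.2 h2)]

lemma deriv1 (ν : Measure ℝ) [IsProbabilityMeasure ν] (hν : ∀ᵐ t ∂ν, t ∈ Set.Icc (0:ℝ) 1) (x : ℝ) (hx : 0 < x) :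
    HasDerivAt (fun y => ∫ t, y / ((1 - t) * y + t) ∂ν)
      (∫ t, t / ((1 - t) * x + t)^2 ∂ν) x := by
  have hm : 0 < min (x/2) 1 := lt_min (by linarith) one_pos
  refine (hasDerivAt_integral_of_dominated_loc_of_deriv_le
    (F := fun y t => y / ((1 - t) * y + t)) (F' := fun y t => t / ((1 - t) * y + t)^2)
    (bound := fun _ => 1 / (min (x/2) 1)^2)
    (s := Set.Ioi (x/2)) (Ioi_mem_nhds (by linarith)) ?_ ?_ ?_ ?_ ?_ ?_).2
  · exact Eventually.of_forall fun y => Measurable.aestronglyMeasurable (by fun_prop)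
  · refine int_bdd ν hν _ (by fun_prop) (x / min (x/2) 1) fun t ht => ?_
    have := den_lb hx ht (show x/2 < x by linarith)
    rw [abs_of_nonneg (div_nonneg hx.le (hm.le.trans this))]
    gcongr
  · exact Measurable.aestronglyMeasurable (by fun_prop)
  · filter_upwards [hν] with t ht y hy
    have := den_lb hx ht hy
    rw [Real.norm_eq_abs, abs_of_nonneg (div_nonneg ht.1 (sq_nonneg _))]
    have := ht.2
    gcongr
  · exact integrable_const _
  · filter_upwards [hν] with t ht y hy
    have h0 := (hm.trans_le (den_lb hx ht hy)).ne'
    have := (hasDerivAt_id y).div (((hasDerivAt_id y).const_mul (1-t)).add_const t) h0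
    refine this.congr_deriv ?_
    congr 1
    simp only [id]
    ring

lemma deriv2 (ν : Measure ℝ) [IsProbabilityMeasure ν] (hν : ∀ᵐ t ∂ν, t ∈ Set.Icc (0:ℝ) 1) (x : ℝ) (hx : 0 < x) :
    HasDerivAt (fun y => ∫ t, t / ((1 - t) * y + t)^2 ∂ν)
      (∫ t, -2*t*(1-t) / ((1 - t) * x + t)^3 ∂ν) x := by
  have hm : 0 < min (x/2) 1 := lt_min (by linarith) one_pos
  refine (hasDerivAt_integral_of_dominated_loc_of_deriv_le
    (F := fun y t => t / ((1 - t) * y + t)^2) (F' := fun y t => -2*t*(1-t) / ((1 - t) * y + t)^3)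
    (bound := fun _ => 2 / (min (x/2) 1)^3)
    (s := Set.Ioi (x/2)) (Ioi_mem_nhds (by linarith)) ?_ ?_ ?_ ?_ ?_ ?_).2
  · exact Eventually.of_forall fun y => Measurable.aestronglyMeasurable (by fun_prop)
  · refine int_bdd ν hν _ (by fun_prop) (1 / (min (x/2) 1)^2) fun t ht => ?_
    have := den_lb hx ht (show x/2 < x by linarith)
    rw [abs_of_nonneg (div_nonneg ht.1 (sq_nonneg _))]
    have := ht.2
    gcongr
  · exact Measurable.aestronglyMeasurable (by fun_prop)
  · filter_upwards [hν] with t ht y hy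
    have h1 := den_lb hx ht hy
    have h2 := hm.trans_le h1
    have h3 : |-2*t*(1-t)| ≤ 2 := by
      rw [abs_le]; constructor <;> nlinarith [ht.1, ht.2]
    rw [Real.norm_eq_abs, abs_div, abs_of_pos (pow_pos h2 3)]
    gcongr
  · exact integrable_const _
  · filter_upwards [hν] with t ht y hy
    have h0 := (hm.trans_le (den_lb hx ht hy)).ne'
    have := (hasDerivAt_const y t).div
      ((((hasDerivAt_id y).const_mul (1-t)).add_const t).pow 2) (pow_ne_zero 2 h0)
    refine this.congr_deriv ?_
    simp only [id] at *
    simp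
    field_simp

lemma oneas {a t : ℝ} (ha : |a| ≤ 1/2) (ht : t ∈ Set.Icc (0:ℝ) 1) :
    |1-2*t| ≤ 1 ∧ |a*(1-2*t)| ≤ 1/2 ∧ 1/2 ≤ 1 - a*(1-2*t) := by
  have h1 : |1-2*t| ≤ 1 := abs_le.2 ⟨by linarith [ht.2], by linarith [ht.1]⟩
  have h2 : |a*(1-2*t)| ≤ 1/2 := by
    rw [abs_mul]; nlinarith [abs_nonneg a, abs_nonneg (1-2*t)]
  exact ⟨h1, h2, by linarith [(abs_le.1 h2).2]⟩

lemma den_eq {a t : ℝ} (h : 1 + a ≠ 0) :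
    (1 - t) * ((1-a)/(1+a)) + t = (1 - a*(1-2*t)) / (1+a) := by
  field_simp; ring

lemma expF (ν : Measure ℝ) [IsProbabilityMeasure ν] (hν : ∀ᵐ t ∂ν, t ∈ Set.Icc (0:ℝ) 1) (h1 : ∫ t, (1 - 2*t) ∂ν = 0) (h3 : ∫ t, (1 - 2*t)^3 ∂ν = 0)
    (a : ℝ) (ha : |a| ≤ 1/2) : ∃ u : ℝ, |u| ≤ 2 ∧
    ∫ t, ((1-a)/(1+a)) / ((1 - t) * ((1-a)/(1+a)) + t) ∂ν
      = (1 - a) * (1 + (∫ t, (1-2*t)^2 ∂ν)*a^2 + (∫ t, (1-2*t)^4 ∂ν)*a^4 + a^5*u) := by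
  have hp : 0 < 1 + a := by linarith [(abs_le.1 ha).1]
  obtain ⟨u, hu, he⟩ := expand_int ν hν h1 h3
    (fun t => ((1-a)/(1+a)) / ((1 - t) * ((1-a)/(1+a)) + t))
    (fun t => (1-2*t)^5 / (1 - a*(1-2*t)))
    ((1-a)*1) ((1-a)*a) ((1-a)*a^2) ((1-a)*a^3) ((1-a)*a^4) ((1-a)*a^5) 2 (by fun_prop)
    (fun t ht => by
      obtain ⟨b1, b2, b3⟩ := oneas ha ht
      rw [abs_div, abs_pow, abs_of_pos (by linarith : 0 < 1 - a*(1-2*t)),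
        div_le_iff₀ (by linarith)]
      have := pow_le_one₀ (n := 5) (abs_nonneg _) b1
      linarith)
    (fun t ht => by
      obtain ⟨b1, b2, b3⟩ := oneas ha ht
      have h0 : 1 - a*(1-2*t) ≠ 0 := by linarith
      rw [den_eq hp.ne']
      generalize 1 - 2*t = s at *
      field_simp
      ring)
  exact ⟨u, hu, by rw [he]; ring⟩

lemma expD (ν : Measure ℝ) [IsProbabilityMeasure ν] (hν : ∀ᵐ t ∂ν, t ∈ Set.Icc (0:ℝ) 1) (h1 : ∫ t, (1 - 2*t) ∂ν = 0) (h3 : ∫ t, (1 - 2*t)^3 ∂ν = 0)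
    (a : ℝ) (ha : |a| ≤ 1/2) : ∃ v : ℝ, |v| ≤ 56 ∧
    ∫ t, t / ((1 - t) * ((1-a)/(1+a)) + t)^2 ∂ν
      = (1 + a)^2 / 2 * (1 - 2*a*(∫ t, (1-2*t)^2 ∂ν) + 3*a^2*(∫ t, (1-2*t)^2 ∂ν)
        - 4*a^3*(∫ t, (1-2*t)^4 ∂ν) + a^4*v) := by
  have hp : 0 < 1 + a := by linarith [(abs_le.1 ha).1]
  obtain ⟨u, hu, he⟩ := expand_int ν hν h1 h3
    (fun t => t / ((1 - t) * ((1-a)/(1+a)) + t)^2)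
    (fun t => (1-(1-2*t))*(1-2*t)^4*(5-4*(a*(1-2*t))) / (1 - a*(1-2*t))^2)
    ((1+a)^2/2*1) ((1+a)^2/2*(2*a-1)) ((1+a)^2/2*(3*a^2-2*a)) ((1+a)^2/2*(4*a^3-3*a^2))
    ((1+a)^2/2*(-4*a^3)) ((1+a)^2/2*a^4) 56 (by fun_prop)
    (fun t ht => by
      obtain ⟨b1, b2, b3⟩ := oneas ha ht
      rw [abs_div, abs_mul, abs_mul, abs_pow, abs_of_pos (by positivity : 0 < (1 - a*(1-2*t))^2),
        div_le_iff₀ (by positivity)]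
      have e1 := pow_le_one₀ (n := 4) (abs_nonneg _) b1
      have e2 : |1-(1-2*t)| ≤ 2 := by
        rw [abs_le] at b1 ⊢; constructor <;> linarith
      have e3 : |5-4*(a*(1-2*t))| ≤ 7 := by
        rw [abs_le] at b2 ⊢; constructor <;> linarith
      have e4 : (1/2)^2 ≤ (1 - a*(1-2*t))^2 := by gcongr
      calc _ ≤ (2:ℝ) * 1 * 7 := by gcongr
        _ ≤ _ := by linarith)
    (fun t ht => by
      obtain ⟨b1, b2, b3⟩ := oneas ha ht
      have h0 : 1 - a*(1-2*t) ≠ 0 := by linarith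
      rw [den_eq hp.ne']
      obtain ⟨s, hs⟩ : ∃ s, s = 1 - 2*t := ⟨_, rfl⟩
      have ht' : t = (1 - s)/2 := by linarith
      rw [← hs] at h0 ⊢
      have h0' : 1 - s*a ≠ 0 := by rwa [mul_comm]
      rw [ht']
      field_simp
      ring)
  exact ⟨u, hu, by rw [he]; ring⟩

lemma expS (ν : Measure ℝ) [IsProbabilityMeasure ν] (hν : ∀ᵐ t ∂ν, t ∈ Set.Icc (0:ℝ) 1) (h1 : ∫ t, (1 - 2*t) ∂ν = 0) (h3 : ∫ t, (1 - 2*t)^3 ∂ν = 0)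
    (a : ℝ) (ha : |a| ≤ 1/2) : ∃ w : ℝ, |w| ≤ 152 ∧
    ∫ t, -2*t*(1-t) / ((1 - t) * ((1-a)/(1+a)) + t)^3 ∂ν
      = -(1 + a)^3 / 2 * (1 - (∫ t, (1-2*t)^2 ∂ν)
        + 6*a^2*((∫ t, (1-2*t)^2 ∂ν) - (∫ t, (1-2*t)^4 ∂ν)) + a^3*w) := by
  have hp : 0 < 1 + a := by linarith [(abs_le.1 ha).1]
  obtain ⟨u, hu, he⟩ := expand_int ν hν h1 h3
    (fun t => -2*t*(1-t) / ((1 - t) * ((1-a)/(1+a)) + t)^3)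
    (fun t => (1-(1-2*t)^2)*(1-2*t)^3*(10-15*(a*(1-2*t))+6*(a*(1-2*t))^2) / (1 - a*(1-2*t))^3)
    (-(1+a)^3/2*1) (-(1+a)^3/2*(3*a)) (-(1+a)^3/2*(6*a^2-1)) (-(1+a)^3/2*(-3*a))
    (-(1+a)^3/2*(-6*a^2)) (-(1+a)^3/2*a^3) 152 (by fun_prop)
    (fun t ht => by
      obtain ⟨b1, b2, b3⟩ := oneas ha ht
      have b4 : 0 < 1 - a*(1-2*t) := by linarith
      rw [abs_div, abs_mul, abs_mul, abs_pow (1-2*t) 3,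
        abs_of_pos (by positivity : 0 < (1 - a*(1-2*t))^3), div_le_iff₀ (by positivity)]
      have e1 := pow_le_one₀ (n := 3) (abs_nonneg _) b1
      have e2 : |1-(1-2*t)^2| ≤ 1 := by
        rw [abs_le] at b1 ⊢; constructor <;> nlinarith
      have e3 : |10-15*(a*(1-2*t))+6*(a*(1-2*t))^2| ≤ 19 := by
        rw [abs_le] at b2 ⊢; constructor <;> nlinarith
      have e4 : (1/2)^3 ≤ (1 - a*(1-2*t))^3 := by gcongr
      calc _ ≤ (1:ℝ) * 1 * 19 := by gcongr
        _ ≤ _ := by linarith)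
    (fun t ht => by
      obtain ⟨b1, b2, b3⟩ := oneas ha ht
      have h0 : 1 - a*(1-2*t) ≠ 0 := by linarith
      rw [den_eq hp.ne']
      obtain ⟨s, hs⟩ : ∃ s, s = 1 - 2*t := ⟨_, rfl⟩
      have ht' : t = (1 - s)/2 := by linarith
      rw [← hs] at h0 ⊢
      have h0' : 1 - s*a ≠ 0 := by rwa [mul_comm]
      rw [ht']
      field_simp
      ring)
  exact ⟨u, hu, by rw [he]; ring⟩

/-- if `μ` is a symmetric Borel probability measure on `[0,1]` with
`12(∫₀¹ t(1−t) dμ)² − ∫₀¹ t(t−1)(20t²−40t+13) dμ < 0`, then the scalar curvature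
of the induced metric has a strict local minimum at the origin. -/
theorem stmt_10 (μ : Measure ℝ) [IsProbabilityMeasure μ]
    (hsupp : μ (Set.Icc 0 1) = 1)
    (hsym : ∀ X : Set ℝ, MeasurableSet X → X ⊆ Set.Icc 0 1 →
      μ X = μ ((fun t => 1 - t) '' X))
    (f : ℝ → ℝ)
    (hf : ∀ x > (0:ℝ), f x = ∫ t in Set.Icc (0:ℝ) 1, x / ((1 - t) * x + t) ∂μ)
    (hcond : 12 * (∫ t in Set.Icc (0:ℝ) 1, t * (1 - t) ∂μ)^2
      - ∫ t in Set.Icc (0:ℝ) 1, t * (t - 1) * (20*t^2 - 40*t + 13) ∂μ < 0) :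
    Tendsto (scurv f) (𝓝[≠] 0) (𝓝 (6 + 36 * iteratedDeriv 2 f 1)) ∧
    ∃ ε > (0:ℝ), ∀ a : ℝ, 0 < |a| → |a| < ε →
      scurv f a > 6 + 36 * iteratedDeriv 2 f 1 := by
  have hν : ∀ᵐ t ∂(μ.restrict (Set.Icc (0:ℝ) 1)), t ∈ Set.Icc (0:ℝ) 1 :=
    ae_restrict_mem measurableSet_Icc
  have hs1 : ∫ t in Set.Icc (0:ℝ) 1, (1 - 2*t) ∂μ = 0 := by
    have := sym_integral μ hsym (fun t => 1 - 2*t) (by fun_prop)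
    have e : ∀ t : ℝ, 1 - 2*(1-t) = -(1-2*t) := fun t => by ring
    simp only [e, integral_neg] at this
    linarith
  have hs3 : ∫ t in Set.Icc (0:ℝ) 1, (1 - 2*t)^3 ∂μ = 0 := by
    have := sym_integral μ hsym (fun t => (1 - 2*t)^3) (by fun_prop)
    have e : ∀ t : ℝ, (1 - 2*(1-t))^3 = -(1-2*t)^3 := fun t => by ring
    simp only [e, integral_neg] at this
    linarith
  have hprob : IsProbabilityMeasure (μ.restrict (Set.Icc (0:ℝ) 1)) :=
    ⟨by rw [Measure.restrict_apply_univ]; exact hsupp⟩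
  clear hsym hsupp
  generalize μ.restrict (Set.Icc (0:ℝ) 1) = ν at *
  -- derivatives
  have hd1 : ∀ x > (0:ℝ), HasDerivAt f (∫ t, t / ((1 - t) * x + t)^2 ∂ν) x := fun x hx => by
    refine (deriv1 ν hν x hx).congr_of_eventuallyEq ?_
    filter_upwards [Ioi_mem_nhds hx] with y hy using hf y hy
  have hd2 : ∀ x > (0:ℝ), iteratedDeriv 2 f x = ∫ t, -2*t*(1-t) / ((1 - t) * x + t)^3 ∂ν :=
    fun x hx => by
    rw [iteratedDeriv_succ, iteratedDeriv_one]
    refine HasDerivAt.deriv ((deriv2 ν hν x hx).congr_of_eventuallyEq ?_)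
    filter_upwards [Ioi_mem_nhds hx] with y hy using (hd1 y hy).deriv
  have hp0 : 0 ≤ ∫ t, (1-2*t)^2 ∂ν := integral_nonneg fun t => by positivity
  have hq0 : 0 ≤ ∫ t, (1-2*t)^4 ∂ν := integral_nonneg fun t => by positivity
  -- the condition in terms of moments
  have hA : ∫ t, t * (1 - t) ∂ν = (1 - ∫ t, (1-2*t)^2 ∂ν)/4 := by
    obtain ⟨ρ, -, h⟩ := expand_int ν hν hs1 hs3 (fun t => t*(1-t)) (fun _ => 0)
      (1/4) 0 (-1/4) 0 0 0 0 measurable_const (by simp) (fun t _ => by ring)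
    rw [h]; ring
  have hB : ∫ t, t * (t - 1) * (20*t^2 - 40*t + 13) ∂ν
      = -(1/4) * (-2 + 7 * (∫ t, (1-2*t)^2 ∂ν) - 5 * ∫ t, (1-2*t)^4 ∂ν) := by
    obtain ⟨ρ, -, h⟩ := expand_int ν hν hs1 hs3
      (fun t => t * (t - 1) * (20*t^2 - 40*t + 13)) (fun _ => 0)
      (1/2) (-10/4) (-7/4) (10/4) (5/4) 0 0 measurable_const (by simp) (fun t _ => by ring)
    rw [h]; ring
  have hr0 : 6 + 36 * iteratedDeriv 2 f 1 = -12 + 18 * ∫ t, (1-2*t)^2 ∂ν := by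
    obtain ⟨w, -, h⟩ := expS ν hν hs1 hs3 0 (by norm_num)
    rw [show ((1:ℝ)-0)/(1+0) = 1 by norm_num, ← hd2 1 one_pos] at h
    rw [h]; ring
  rw [hA, hB] at hcond
  have hex : ∀ a : ℝ, |a| ≤ 1/2 → ∃ u v w : ℝ, |u| ≤ 2 ∧ |v| ≤ 56 ∧ |w| ≤ 152 ∧
      f ((1-a)/(1+a)) = (1 - a) * (1 + (∫ t, (1-2*t)^2 ∂ν)*a^2 + (∫ t, (1-2*t)^4 ∂ν)*a^4 + a^5*u) ∧
      deriv f ((1-a)/(1+a)) = (1 + a)^2 / 2 * (1 - 2*a*(∫ t, (1-2*t)^2 ∂ν)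
        + 3*a^2*(∫ t, (1-2*t)^2 ∂ν) - 4*a^3*(∫ t, (1-2*t)^4 ∂ν) + a^4*v) ∧
      iteratedDeriv 2 f ((1-a)/(1+a)) = -(1 + a)^3 / 2 * (1 - (∫ t, (1-2*t)^2 ∂ν)
        + 6*a^2*((∫ t, (1-2*t)^2 ∂ν) - (∫ t, (1-2*t)^4 ∂ν)) + a^3*w) := by
    intro a ha
    have hc : 0 < (1-a)/(1+a) := div_pos (by linarith [(abs_le.1 ha).2])
      (by linarith [(abs_le.1 ha).1])
    obtain ⟨u, hu, hu'⟩ := expF ν hν hs1 hs3 a ha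
    obtain ⟨v, hv, hv'⟩ := expD ν hν hs1 hs3 a ha
    obtain ⟨w, hw, hw'⟩ := expS ν hν hs1 hs3 a ha
    exact ⟨u, v, w, hu, hv, hw, by rw [hf _ hc, hu'], by rw [(hd1 _ hc).deriv, hv'],
      by rw [hd2 _ hc, hw']⟩
  rw [hr0]
  generalize (∫ t, (1-2*t)^2 ∂ν) = p at *
  generalize (∫ t, (1-2*t)^4 ∂ν) = q at *
  obtain ⟨C, hC⟩ : ∃ C, C = -10*(1+p+3*p^2-5*q) := ⟨_, rfl⟩
  have hCpos : 0 < C := by rw [hC]; nlinarith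
  obtain ⟨K, hK, hKb⟩ := remP_bdd p q
  have main : ∀ a : ℝ, a ≠ 0 → |a| ≤ 1/2 →
      |scurv f a - (-12 + 18*p) - C*a^2| ≤ K * |a|^3 := by
    intro a ha0 ha
    obtain ⟨u, v, w, hu, hv, hw, hF, hD, hS⟩ := hex a ha
    have ha1 := abs_le.1 ha
    have hg : 15/16 ≤ 1 + p*a^2 + q*a^4 + a^5*u := by
      have h5 : |a^5*u| ≤ (1/2)^5*2 := by
        rw [abs_mul, abs_pow]; gcongr
      have := (abs_le.1 h5).1
      have : 0 ≤ p*a^2 := by positivity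
      have : 0 ≤ q*a^4 := by positivity
      linarith
    have key := scurv_alg a p q u v w _ _ _ ha0 (by linarith) (by linarith) (by linarith) hF hD hS
    rw [← hC] at key
    change (scurv f a - (-12 + 18*p) - C*a^2) * _ = _ at key
    have hden : 1 ≤ 2*(1-a)*(1+a)*(1 + p*a^2 + q*a^4 + a^5*u)^2 := by
      have h1 : 3/2 ≤ 2*(1-a)*(1+a) := by nlinarith
      have h2 : (15/16)^2 ≤ (1 + p*a^2 + q*a^4 + a^5*u)^2 := by gcongr
      calc (1:ℝ) ≤ 3/2 * (15/16)^2 := by norm_num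
        _ ≤ _ := by gcongr
    have hb := hKb a u v w ha hu hv hw
    have habs := congrArg abs key
    rw [abs_mul, abs_mul (a^3), abs_pow, abs_of_pos (by linarith :
      0 < 2*(1-a)*(1+a)*(1 + p*a^2 + q*a^4 + a^5*u)^2)] at habs
    calc _ ≤ |scurv f a - (-12 + 18*p) - C*a^2| * (2*(1-a)*(1+a)*(1 + p*a^2 + q*a^4 + a^5*u)^2) :=
          le_mul_of_one_le_right (abs_nonneg _) hden
      _ = |a|^3 * |remP a p q u v w| := habs
      _ ≤ |a|^3 * K := by gcongr
      _ = _ := mul_comm _ _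
  constructor
  · rw [tendsto_iff_norm_sub_tendsto_zero]
    have hlim : Tendsto (fun a : ℝ => K*|a|^3 + C*a^2) (𝓝[≠] 0) (𝓝 0) := by
      have : Continuous (fun a : ℝ => K*|a|^3 + C*a^2) := by fun_prop
      have h := this.tendsto 0
      simp only [abs_zero] at h
      refine Tendsto.mono_left ?_ nhdsWithin_le_nhds
      simpa using h
    refine squeeze_zero' (Eventually.of_forall fun _ => norm_nonneg _) ?_ hlim
    have hn : Metric.ball (0:ℝ) (1/2) ∈ 𝓝[≠] (0:ℝ) :=
      mem_nhdsWithin_of_mem_nhds (Metric.ball_mem_nhds _ (by norm_num))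
    filter_upwards [hn, self_mem_nhdsWithin] with a ha ha0
    have h := main a ha0 (by simpa using (mem_ball_zero_iff.1 ha).le)
    rw [Real.norm_eq_abs]
    have h' := abs_le.1 h
    have : 0 ≤ C*a^2 := by positivity
    rw [abs_le]; constructor <;> linarith
  · refine ⟨min (1/2) (C/K), lt_min (by norm_num) (div_pos hCpos hK), fun a ha0 ha => ?_⟩
    have h := (abs_le.1 (main a (abs_pos.1 ha0) (ha.le.trans (min_le_left _ _)))).1
    have h2 : |a| * K < C := (lt_div_iff₀ hK).1 (ha.trans_le (min_le_right _ _))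
    have h3 : K*|a|^3 < C*a^2 := by
      rw [← sq_abs a]
      have := mul_lt_mul_of_pos_right h2 (pow_pos ha0 2)
      nlinarith
    linarith
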